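/- arXiv:1505.07666 — 6 statements merged into one kernel-verified Lean document; each statement's English description precedes it below -/
import Mathlib

section
/- Let α_m, α_f, β, γ, ω, Δt be real numbers with Δt > 0, set Ω = ωΔt and D = 1 − α_m + (1 − α_f)βΩ², and assume D ≠ 0. Suppose the real numbers q_i, v_i, a_i, q_{i+1}, v_{i+1}, a_{i+1} satisfy the generalized-α relations for the undamped oscillator q̈ + ω²q = 0: (1 − α_m)a_{i+1} + α_m a_i + ω²((1 − α_f)q_{i+1} + α_f q_i) = 0, q_{i+1} = q_i + Δt v_i + Δt²((1/2 − β)a_i + β a_{i+1}), and v_{i+1} = v_i + Δt((1 − γ)a_i + γ a_{i+1}). Then the state vector X_{i+1} = (q_{i+1}, Δt v_{i+1}, Δt² a_{i+1}) equals (1/D)·A·X_i, where X_i = (q_i, Δt v_i, Δt² a_i) and A is the 3×3 matrix with rows [1 − α_m − α_f βΩ², 1 − α_m, (1/2 − β)(1 − α_m) − βα_m], [−γΩ², 1 − α_m − (1 − α_f)(γ − β)Ω², (1 − γ)(1 − α_m) − γα_m − (1 − α_f)(γ/2 − β)Ω²], [−Ω², −(1 − α_f)Ω², −(1 − α_f)(1/2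 − β)Ω² − α_m]. -/
/-- The generalized-α method applied to the undamped oscillator `q̈ + ω²q = 0`
propagates the state vector `(q, Δt v, Δt² a)` by the amplification matrix `(1/D)·A`. -/
theorem genAlpha_amplification
    (αm αf β γ ω Δt : ℝ) (hΔt : 0 < Δt)
    (Ω D : ℝ) (hΩ : Ω = ω * Δt)
    (hD : D = 1 - αm + (1 - αf) * β * Ω ^ 2) (hD0 : D ≠ 0)
    (qi vi ai qi1 vi1 ai1 : ℝ)
    (heq : (1 - αm) * ai1 + αm * ai + ω ^ 2 * ((1 - αf) * qi1 + αf * qi) = 0)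
    (hq : qi1 = qi + Δt * vi + Δt ^ 2 * ((1 / 2 - β) * ai + β * ai1))
    (hv : vi1 = vi + Δt * ((1 - γ) * ai + γ * ai1)) :
    (![qi1, Δt * vi1, Δt ^ 2 * ai1] : Fin 3 → ℝ) =
      (1 / D) •
        (Matrix.mulVec
          !![1 - αm - αf * β * Ω ^ 2, 1 - αm, (1 / 2 - β) * (1 - αm) - β * αm;
             -(γ * Ω ^ 2), 1 - αm - (1 - αf) * (γ - β) * Ω ^ 2,
               (1 - γ) * (1 - αm) - γ * αm - (1 - αf) * (γ / 2 - β) * Ω ^ 2;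
             -(Ω ^ 2), -((1 - αf) * Ω ^ 2), -((1 - αf) * (1 / 2 - β) * Ω ^ 2) - αm]
          ![qi, Δt * vi, Δt ^ 2 * ai]) := by
  have hacc : D * (Δt ^ 2 * ai1) =
      -(Ω ^ 2) * qi - (1 - αf) * Ω ^ 2 * (Δt * vi)
        - ((1 - αf) * (1 / 2 - β) * Ω ^ 2 + αm) * (Δt ^ 2 * ai) := by
    subst hD hΩ hq
    linear_combination Δt ^ 2 * heq
  rw [one_div, eq_inv_smul_iff₀ hD0]
  ext j
  fin_cases j
  · simp [Matrix.mulVec, dotProduct, Fin.sum_univ_three]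
    linear_combination D * hq + β * hacc
      + (qi + Δt * vi + (1 / 2 - β) * (Δt ^ 2 * ai)) * hD
  · simp [Matrix.mulVec, dotProduct, Fin.sum_univ_three]
    linear_combination D * Δt * hv + γ * hacc
      + (Δt * vi + (1 - γ) * (Δt ^ 2 * ai)) * hD
  · simp [Matrix.mulVec, dotProduct, Fin.sum_univ_three]
    linear_combination hacc
end

section
/- Let α_m, α_f, β, γ be real numbers with β ≠ 0 and α_f ≠ 1, and let A_∞ be the 3×3 real matrix with rows [α_f/(α_f − 1), 0, 0], [−γ/((1 − α_f)β), −(γ − β)/β, −(γ/2 − β)/β], [−1/((1 − α_f)β), −1/β, −(1/2 − β)/β]. Then the characteristic polynomial of A_∞ equals (X − α_f/(α_f − 1))·(X² − ((4β − (2γ + 1))/(2β))·X + (2β + 1 − 2γ)/(2β)). In particular, if 16β ≥ (2γ + 1)², the two roots of the quadratic factor (over ℂ) are λ_{1,2}^∞ = (4β − (2γ + 1) ± i·√(16β − (2γ + 1)²))/(4β), so the complex eigenvalues of A_∞ are exactly α_f/(α_f − 1) and λ_{1,2}^∞. -/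
open Polynomial

/-- Characteristic polynomial of a `3 × 3` block lower triangular matrix with blocks of size
`1` and `2`. -/
theorem charpoly_fin_three_of_first_row {R : Type*} [CommRing R] (a b c d e f g : R) :
    (!![a, 0, 0; b, c, d; e, f, g] : Matrix (Fin 3) (Fin 3) R).charpoly =
      (X - C a) * (X ^ 2 - C (c + g) * X + C (c * g - d * f)) := by
  simp [Matrix.charpoly, Matrix.det_fin_three]
  ring

/-- Characteristic polynomial and eigenvalues of the high-frequency limit matrix
`A_∞` of the generalized-α method. -/
theorem genAlpha_Ainf_charpoly
    (αm αf β γ : ℝ) (hβ : β ≠ 0) (hαf : αf ≠ 1)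
    (Ainf : Matrix (Fin 3) (Fin 3) ℝ)
    (hAinf : Ainf =
      !![αf / (αf - 1), 0, 0;
         -(γ / ((1 - αf) * β)), -((γ - β) / β), -((γ / 2 - β) / β);
         -(1 / ((1 - αf) * β)), -(1 / β), -((1 / 2 - β) / β)]) :
    Ainf.charpoly =
      (X - C (αf / (αf - 1))) *
        (X ^ 2 - C ((4 * β - (2 * γ + 1)) / (2 * β)) * X
          + C ((2 * β + 1 - 2 * γ) / (2 * β))) ∧
    (16 * β ≥ (2 * γ + 1) ^ 2 →
      ∀ lam : ℂ, ((Ainf.map Complex.ofReal).charpoly.eval lam = 0 ↔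
        (lam = ((αf : ℂ) / ((αf : ℂ) - 1)) ∨
         lam = ((4 * (β : ℂ) - (2 * (γ : ℂ) + 1))
                + Complex.I * (Real.sqrt (16 * β - (2 * γ + 1) ^ 2) : ℝ)) / (4 * (β : ℂ)) ∨
         lam = ((4 * (β : ℂ) - (2 * (γ : ℂ) + 1))
                - Complex.I * (Real.sqrt (16 * β - (2 * γ + 1) ^ 2) : ℝ)) / (4 * (β : ℂ))))) := by
  have hcp : Ainf.charpoly =
      (X - C (αf / (αf - 1))) *
        (X ^ 2 - C ((4 * β - (2 * γ + 1)) / (2 * β)) * X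
          + C ((2 * β + 1 - 2 * γ) / (2 * β))) := by
    rw [hAinf, charpoly_fin_three_of_first_row]
    congr 4
    · congr 2
      field_simp
      ring
    · field_simp
      ring
  refine ⟨hcp, fun h lam => ?_⟩
  have hβ' : (β : ℂ) ≠ 0 := Complex.ofReal_ne_zero.mpr hβ
  have hs : ((Real.sqrt (16 * β - (2 * γ + 1) ^ 2) : ℝ) : ℂ) ^ 2 =
      16 * β - (2 * γ + 1) ^ 2 := by
    rw [← Complex.ofReal_pow, Real.sq_sqrt (by linarith)]
    push_cast
    ring
  generalize ((Real.sqrt (16 * β - (2 * γ + 1) ^ 2) : ℝ) : ℂ) = s at hs ⊢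
  have hfac : (Ainf.map Complex.ofReal).charpoly.eval lam =
      (lam - (αf : ℂ) / ((αf : ℂ) - 1)) *
        ((lam - ((4 * (β : ℂ) - (2 * (γ : ℂ) + 1)) + Complex.I * s) / (4 * (β : ℂ))) *
          (lam - ((4 * (β : ℂ) - (2 * (γ : ℂ) + 1)) - Complex.I * s) / (4 * (β : ℂ)))) := by
    have hmap : (Ainf.map Complex.ofReal).charpoly = Ainf.charpoly.map Complex.ofRealHom :=
      Matrix.charpoly_map Ainf Complex.ofRealHom
    rw [hmap, hcp]
    simp only [Polynomial.map_mul, Polynomial.map_sub, Polynomial.map_add, Polynomial.map_pow,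
      map_X, map_C, eval_mul, eval_sub, eval_add, eval_pow, eval_X, eval_C,
      Complex.ofRealHom_eq_coe]
    push_cast
    congr 1
    field_simp
    linear_combination (-2 : ℂ) * hs + (2 : ℂ) * s ^ 2 * Complex.I_sq
  rw [hfac, mul_eq_zero, mul_eq_zero, sub_eq_zero, sub_eq_zero, sub_eq_zero]
end

section
/- Let ω be a real number, Δt > 0, Ω = ωΔt, and D = (16 + Ω²)(9 + Ω²). Suppose the real numbers q_i, v_i, a_i, q_h, v_h, a_h, q_{i+1}, v_{i+1}, a_{i+1} satisfy the Bathe-method relations for the undamped oscillator q̈ + ω²q = 0: v_h = v_i + (Δt/4)(a_i + a_h), q_h = q_i + (Δt/4)(v_i + v_h), a_h = −ω²q_h (trapezoidal first sub-step), and v_{i+1} = (q_i − 4q_h + 3q_{i+1})/Δt, a_{i+1} = (v_i − 4v_h + 3v_{i+1})/Δt, a_{i+1} = −ω²q_{i+1} (Euler-backward second sub-step). Then q_{i+1} = [(144 − 19Ω²)q_i + (144 − 5Ω²)Δt v_i + 28 Δt² a_i]/D, Δt v_{i+1} = [(Ω⁴ − 96Ω²)q_i + (144 − 47Ω²)Δt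 v_i + (48 − 4Ω²)Δt² a_i]/D, and Δt² a_{i+1} = [(19Ω⁴ − 144Ω²)q_i + (5Ω⁴ − 144Ω²)Δt v_i − 28Ω² Δt² a_i]/D; i.e., the state vector (q, Δt v, Δt² a) is propagated by an explicit 3×3 amplification matrix A_Bathe(Ω) with these rows. -/
/-- The Bathe method applied to the undamped oscillator `q̈ + ω²q = 0`
(trapezoidal rule on the first half step, 3-point Euler backward on the second
half step) propagates the state `(q, Δt v, Δt² a)` by the explicit
amplification matrix `A_Bathe(Ω)`. -/
theorem bathe_amplification
    (ω Δt : ℝ) (hΔt : 0 < Δt)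
    (Ω D : ℝ) (hΩ : Ω = ω * Δt)
    (hD : D = (16 + Ω ^ 2) * (9 + Ω ^ 2))
    (qi vi ai qh vh ah qi1 vi1 ai1 : ℝ)
    (hvh : vh = vi + (Δt / 4) * (ai + ah))
    (hqh : qh = qi + (Δt / 4) * (vi + vh))
    (hah : ah = -(ω ^ 2) * qh)
    (hv1 : vi1 = (qi - 4 * qh + 3 * qi1) / Δt)
    (ha1 : ai1 = (vi - 4 * vh + 3 * vi1) / Δt)
    (heq1 : ai1 = -(ω ^ 2) * qi1) :
    qi1 = ((144 - 19 * Ω ^ 2) * qi + (144 - 5 * Ω ^ 2) * (Δt * vi)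
            + 28 * (Δt ^ 2 * ai)) / D ∧
    Δt * vi1 = ((Ω ^ 4 - 96 * Ω ^ 2) * qi + (144 - 47 * Ω ^ 2) * (Δt * vi)
            + (48 - 4 * Ω ^ 2) * (Δt ^ 2 * ai)) / D ∧
    Δt ^ 2 * ai1 = ((19 * Ω ^ 4 - 144 * Ω ^ 2) * qi
            + (5 * Ω ^ 4 - 144 * Ω ^ 2) * (Δt * vi)
            - 28 * Ω ^ 2 * (Δt ^ 2 * ai)) / D := by
  have hne : Δt ≠ 0 := hΔt.ne'
  have hDpos : D ≠ 0 := by rw [hD]; positivity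
  have hW : Ω ^ 2 = ω ^ 2 * Δt ^ 2 := by rw [hΩ]; ring
  have hV1 : Δt * vi1 = qi - 4 * qh + 3 * qi1 := by rw [hv1]; field_simp
  have hA1 : Δt * ai1 = vi - 4 * vh + 3 * vi1 := by rw [ha1]; field_simp
  have hah' : Δt ^ 2 * ah = -Ω ^ 2 * qh := by rw [hah, hW]; ring
  have hai1 : Δt ^ 2 * ai1 = -Ω ^ 2 * qi1 := by rw [heq1, hW]; ring
  have hQh : (16 + Ω ^ 2) * qh = 16 * qi + 8 * (Δt * vi) + Δt ^ 2 * ai := by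
    linear_combination 16 * hqh + 4 * Δt * hvh + hah'
  have hQ1 : (9 + Ω ^ 2) * qi1
      = 3 * (Δt * vi) + Δt ^ 2 * ai - 3 * qi + (12 - Ω ^ 2) * qh := by
    linear_combination hai1 - Δt * hA1 - 3 * hV1 + 4 * Δt * hvh + hah'
  have hq : D * qi1 = (144 - 19 * Ω ^ 2) * qi + (144 - 5 * Ω ^ 2) * (Δt * vi)
      + 28 * (Δt ^ 2 * ai) := by
    linear_combination qi1 * hD + (16 + Ω ^ 2) * hQ1 + (12 - Ω ^ 2) * hQh
  refine ⟨?_, ?_, ?_⟩ <;> rw [eq_div_iff hDpos]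
  · linear_combination hq
  · linear_combination D * hV1 + 3 * hq + (qi - 4 * qh) * hD - 4 * (9 + Ω ^ 2) * hQh
  · linear_combination D * hai1 - Ω ^ 2 * hq
end

section
/- For Ω > 0, let A_Bathe(Ω) be the 3×3 real matrix with rows [(144 − 19Ω²)/D, (144 − 5Ω²)/D, 28/D], [(Ω⁴ − 96Ω²)/D, (144 − 47Ω²)/D, (48 − 4Ω²)/D], [(19Ω⁴ − 144Ω²)/D, (5Ω⁴ − 144Ω²)/D, −28Ω²/D], where D = (16 + Ω²)(9 + Ω²). Then, as Ω → ∞, A_Bathe(Ω) converges entrywise to the matrix N with rows [0, 0, 0], [1, 0, 0], [19, 5, 0], and N is nilpotent (N³ = 0), so every eigenvalue of the high-frequency limit matrix is 0; i.e., the Bathe method has high-frequency spectral radius ρ_∞ = 0 (asymptotic annihilation). -/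
/-- An even quartic divided by `(16 + x²)(9 + x²)` tends to its leading coefficient. -/
theorem tendsto_even_quartic_div_atTop (a b c : ℝ) :
    Filter.Tendsto (fun x : ℝ => (a * x ^ 4 + b * x ^ 2 + c) / ((16 + x ^ 2) * (9 + x ^ 2)))
      Filter.atTop (nhds a) := by
  have hcont : ContinuousAt (fun y : ℝ =>
      (a + b * y ^ 2 + c * y ^ 4) / ((16 * y ^ 2 + 1) * (9 * y ^ 2 + 1))) 0 :=
    ContinuousAt.div (by fun_prop) (by fun_prop) (by norm_num)
  have hlim := hcont.tendsto.comp (tendsto_inv_atTop_zero (𝕜 := ℝ))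
  simp only [ne_eq, OfNat.ofNat_ne_zero, not_false_eq_true, zero_pow, mul_zero, add_zero,
    zero_add, mul_one, div_one] at hlim
  refine hlim.congr' ?_
  filter_upwards [Filter.eventually_gt_atTop 0] with x hx
  simp only [Function.comp_apply]
  field_simp

/-- Asymptotic annihilation of the Bathe method: as `Ω → ∞` the amplification
matrix converges entrywise to the nilpotent matrix `N` with rows
`[0,0,0], [1,0,0], [19,5,0]`; in particular `N³ = 0` and every complex
eigenvalue of `N` equals `0`, so `ρ_∞ = 0`. -/
theorem bathe_asymptotic_annihilation
    (D : ℝ → ℝ) (hD : ∀ Ω, D Ω = (16 + Ω ^ 2) * (9 + Ω ^ 2))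
    (A : ℝ → Matrix (Fin 3) (Fin 3) ℝ)
    (hA : ∀ Ω, 0 < Ω → A Ω =
      !![(144 - 19 * Ω ^ 2) / D Ω, (144 - 5 * Ω ^ 2) / D Ω, 28 / D Ω;
         (Ω ^ 4 - 96 * Ω ^ 2) / D Ω, (144 - 47 * Ω ^ 2) / D Ω, (48 - 4 * Ω ^ 2) / D Ω;
         (19 * Ω ^ 4 - 144 * Ω ^ 2) / D Ω, (5 * Ω ^ 4 - 144 * Ω ^ 2) / D Ω,
           -(28 * Ω ^ 2) / D Ω])
    (N : Matrix (Fin 3) (Fin 3) ℝ)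
    (hN : N = !![0, 0, 0; 1, 0, 0; 19, 5, 0]) :
    Filter.Tendsto A Filter.atTop (nhds N) ∧
    N ^ 3 = 0 ∧
    (∀ lam : ℂ, (N.map Complex.ofReal).charpoly.eval lam = 0 → lam = 0) := by
  subst hN
  refine ⟨?_, ?_, ?_⟩
  · have entry (a b c : ℝ) (f : ℝ → ℝ)
        (hf : ∀ Ω, 0 < Ω → f Ω = (a * Ω ^ 4 + b * Ω ^ 2 + c) / D Ω) :
        Filter.Tendsto f Filter.atTop (nhds a) := by
      refine (tendsto_even_quartic_div_atTop a b c).congr' ?_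
      filter_upwards [Filter.eventually_gt_atTop 0] with Ω hΩ
      rw [hf Ω hΩ, hD]
    refine tendsto_pi_nhds.2 fun i => tendsto_pi_nhds.2 fun j => ?_
    fin_cases i <;> fin_cases j
    · exact entry 0 (-19) 144 _ fun Ω hΩ => by simp [hA Ω hΩ]; ring
    · exact entry 0 (-5) 144 _ fun Ω hΩ => by simp [hA Ω hΩ]; ring
    · exact entry 0 0 28 _ fun Ω hΩ => by simp [hA Ω hΩ]
    · exact entry 1 (-96) 0 _ fun Ω hΩ => by simp [hA Ω hΩ]; ring
    · exact entry 0 (-47) 144 _ fun Ω hΩ => by simp [hA Ω hΩ]; ring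
    · exact entry 0 (-4) 48 _ fun Ω hΩ => by simp [hA Ω hΩ]; ring
    · exact entry 19 (-144) 0 _ fun Ω hΩ => by simp [hA Ω hΩ]; ring
    · exact entry 5 (-144) 0 _ fun Ω hΩ => by simp [hA Ω hΩ]; ring
    · exact entry 0 (-28) 0 _ fun Ω hΩ => by simp [hA Ω hΩ]
  · ext i j
    fin_cases i <;> fin_cases j <;> simp [pow_succ, Matrix.mul_apply, Fin.sum_univ_three]
  · intro lam h
    rw [Matrix.eval_charpoly, Matrix.det_fin_three] at h
    simpa using h
end

section
/- Let r > 0, μ ≥ 0, λ_N ≥ 0 be real numbers and let λ_T, v be real numbers. Then λ_T equals the projection of λ_T − r·v onto the interval [−μλ_N, μλ_N] (i.e., λ_T = max(−μλ_N, min(μλ_N, λ_T − r·v))) if and only if Coulomb's friction law holds: either v = 0 and |λ_T| ≤ μλ_N (sticking), or v ≠ 0 and λ_T = −(v/|v|)·μλ_N (sliding). -/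
/-- The projection formulation of Coulomb's friction law (scalar case) is
equivalent to the stick/slip disjunction: for `r > 0`, `μ ≥ 0`, `λ_N ≥ 0`,
`λ_T = proj_{[−μλ_N, μλ_N]}(λ_T − r·v)` iff either `v = 0` and `|λ_T| ≤ μλ_N`
(sticking) or `v ≠ 0` and `λ_T = −(v/|v|)·μλ_N` (sliding). -/
theorem projection_iff_coulomb
    (r μ lamN lamT v : ℝ) (hr : 0 < r) (hμ : 0 ≤ μ) (hN : 0 ≤ lamN) :
    lamT = max (-(μ * lamN)) (min (μ * lamN) (lamT - r * v)) ↔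
      ((v = 0 ∧ |lamT| ≤ μ * lamN) ∨
       (v ≠ 0 ∧ lamT = -(v / |v|) * (μ * lamN))) := by
  have hc : 0 ≤ μ * lamN := mul_nonneg hμ hN
  generalize μ * lamN = c at hc ⊢
  rcases lt_trichotomy v 0 with hv | rfl | hv
  · have hrv : r * v < 0 := mul_neg_of_pos_of_neg hr hv
    have hsign : v / |v| = -1 := by rw [abs_of_neg hv, div_neg, div_self hv.ne]
    simp only [hv.ne, hsign, false_and, false_or, ne_eq, not_false_eq_true, true_and]
    grind
  · simp only [mul_zero, sub_zero, true_and, ne_eq, not_true_eq_false, false_and, or_false, abs_le]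
    grind
  · have hrv : 0 < r * v := mul_pos hr hv
    have hsign : v / |v| = 1 := by rw [abs_of_pos hv, div_self hv.ne']
    simp only [hv.ne', hsign, false_and, false_or, ne_eq, not_false_eq_true, true_and]
    grind
end

section
/- Let E be a real inner product space, let r > 0 and R ≥ 0 be real numbers, and let λ_T, v ∈ E. Suppose λ_T is a nearest point of the closed ball B̄(0, R) to the point λ_T − r·v, i.e., ‖λ_T‖ ≤ R and ‖(λ_T − r·v) − λ_T‖ ≤ ‖(λ_T − r·v) − z‖ for every z with ‖z‖ ≤ R. Then either v = 0 and ‖λ_T‖ ≤ R, or v ≠ 0 and λ_T = −(R/‖v‖)·v. Conversely, each of these two alternatives implies that λ_T is a nearest point of B̄(0, R) to λ_T − r·v. -/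
/-- A point of a convex set that is nearest to `x` satisfies the variational inequality. -/
theorem Convex.inner_sub_nonpos_of_forall_norm_sub_le
    {E : Type*} [NormedAddCommGroup E] [InnerProductSpace ℝ E] {C : Set E} (hC : Convex ℝ C)
    {x y z : E} (hy : y ∈ C) (hmin : ∀ w ∈ C, ‖x - y‖ ≤ ‖x - w‖) (hz : z ∈ C) :
    inner ℝ (x - y) (z - y) ≤ 0 := by
  have : Nonempty C := ⟨⟨y, hy⟩⟩
  refine (norm_eq_iInf_iff_real_inner_le_zero hC hy).1 (le_antisymm ?_ ?_) z hz
  · exact le_ciInf fun w => hmin w w.2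
  · exact ciInf_le ⟨0, Set.forall_mem_range.2 fun _ => norm_nonneg _⟩ (⟨y, hy⟩ : C)

/-- Equality case of the Cauchy–Schwarz inequality on a ball of radius `R`. -/
theorem eq_neg_div_norm_smul_of_inner_le
    {E : Type*} [NormedAddCommGroup E] [InnerProductSpace ℝ E] {R : ℝ} {x v : E}
    (hv : v ≠ 0) (hx : ‖x‖ ≤ R) (h : inner ℝ x v ≤ -(R * ‖v‖)) :
    x = -((R / ‖v‖) • v) := by
  have hv' : 0 < ‖v‖ := norm_pos_iff.2 hv
  have hR : 0 ≤ R := (norm_nonneg x).trans hx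
  have hs : ‖(R / ‖v‖) • v‖ = R := by
    rw [norm_smul, Real.norm_of_nonneg (by positivity), div_mul_cancel₀ _ hv'.ne']
  have hi : inner ℝ x ((R / ‖v‖) • v) ≤ -R ^ 2 := by
    rw [real_inner_smul_right]
    calc R / ‖v‖ * inner ℝ x v ≤ R / ‖v‖ * -(R * ‖v‖) := by gcongr
      _ = -R ^ 2 := by field_simp
  have hsq : ‖x + (R / ‖v‖) • v‖ ^ 2 ≤ 0 := by
    rw [norm_add_sq_real, hs]
    nlinarith [norm_nonneg x]
  exact eq_neg_of_add_eq_zero_left <| norm_eq_zero.1 <|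
    pow_eq_zero_iff two_ne_zero |>.1 <| le_antisymm hsq (sq_nonneg _)

/-- In a real inner product space, `λ_T` is a nearest point of the closed ball
`B̄(0,R)` to `λ_T − r·v` if and only if either `v = 0` and `‖λ_T‖ ≤ R`
(sticking) or `v ≠ 0` and `λ_T = −(R/‖v‖)·v` (sliding). -/
theorem coulomb_ball_projection
    {E : Type*} [NormedAddCommGroup E] [InnerProductSpace ℝ E]
    (r R : ℝ) (hr : 0 < r) (hR : 0 ≤ R) (lamT v : E) :
    (‖lamT‖ ≤ R ∧
      ∀ z : E, ‖z‖ ≤ R → ‖(lamT - r • v) - lamT‖ ≤ ‖(lamT - r • v) - z‖) ↔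
    ((v = 0 ∧ ‖lamT‖ ≤ R) ∨ (v ≠ 0 ∧ lamT = -((R / ‖v‖) • v))) := by
  constructor
  · rintro ⟨hl, hmin⟩
    by_cases hv : v = 0
    · exact Or.inl ⟨hv, hl⟩
    refine Or.inr ⟨hv, eq_neg_div_norm_smul_of_inner_le hv hl ?_⟩
    have hv' : 0 < ‖v‖ := norm_pos_iff.2 hv
    have hs : ‖-((R / ‖v‖) • v)‖ ≤ R := by
      rw [norm_neg, norm_smul, Real.norm_of_nonneg (by positivity), div_mul_cancel₀ _ hv'.ne']
    have hvar := (convex_closedBall (0 : E) R).inner_sub_nonpos_of_forall_norm_sub_le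
      (mem_closedBall_zero_iff.2 hl) (fun w hw => hmin w (mem_closedBall_zero_iff.1 hw))
      (mem_closedBall_zero_iff.2 hs)
    rw [sub_sub_cancel_left, inner_neg_left, real_inner_smul_left, inner_sub_right,
      inner_neg_right, real_inner_smul_right, real_inner_self_eq_norm_sq] at hvar
    have hdiv : R / ‖v‖ * ‖v‖ ^ 2 = R * ‖v‖ := by field_simp
    rw [hdiv, real_inner_comm] at hvar
    nlinarith
  · rintro (⟨rfl, hl⟩ | ⟨hv, rfl⟩)
    · exact ⟨hl, fun z _ => by simp⟩
    have hv' : 0 < ‖v‖ := norm_pos_iff.2 hv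
    refine ⟨?_, fun z hz => ?_⟩
    · rw [norm_neg, norm_smul, Real.norm_of_nonneg (by positivity), div_mul_cancel₀ _ hv'.ne']
    · have hn : ‖-((R / ‖v‖) • v) - r • v‖ = R + r * ‖v‖ := by
        rw [← neg_add', ← add_smul, norm_neg, norm_smul, Real.norm_of_nonneg (by positivity),
          add_mul, div_mul_cancel₀ _ hv'.ne']
      have htri := norm_sub_norm_le (-((R / ‖v‖) • v) - r • v) z
      rw [sub_sub_cancel_left, norm_neg, norm_smul, Real.norm_of_nonneg hr.le]
      linarith
end
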